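/- Let X be a metric space, (π_j) Borel probability measures on X converging weakly to a Borel probability measure π, and f : X → ℝ a continuous function with π({f > 0}) = 1. For R > 0 set Ω_R := {x ∈ X : f(x) > 1/R}. Then there exists a sequence R_k ∈ (0,∞) with R_k → ∞ such that: (i) there exists k₀ with π(Ω_{R_k}) > 0 for all k ≥ k₀; (ii) for every k, π_j(Ω_{R_k}) → π(Ω_{R_k}) as j → ∞; (iii) for every k ≥ k₀, π_j(Ω_{R_k}) > 0 for all sufficiently large j, and the normalized restricted probability measures π_j(Ω_{R_k})⁻¹ · π_j|_{Ω_{R_k}} converge weakly to π(Ω_{R_k})⁻¹ · π|_{Ω_{R_k}} as j → ∞. -/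

import Mathlib

open MeasureTheory Filter Topology

open ProbabilityTheory in
/-- Conditioning on an open continuity set of positive limit measure preserves weak convergence. -/
theorem tendsto_integral_cond_of_null_frontier {X ι : Type*} [MeasurableSpace X]
    [TopologicalSpace X] [OpensMeasurableSpace X] [HasOuterApproxClosed X]
    {L : Filter ι} [L.IsCountablyGenerated] {μs : ι → ProbabilityMeasure X}
    {μ : ProbabilityMeasure X} (hμ : Tendsto μs L (𝓝 μ)) {U : Set X} (hU : IsOpen U)
    (hfr : (μ : Measure X) (frontier U) = 0) (hpos : (μ : Measure X) U ≠ 0)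
    (g : BoundedContinuousFunction X ℝ) :
    Tendsto (fun i ↦ ∫ x, g x ∂(cond (μs i : Measure X) U)) L
      (𝓝 (∫ x, g x ∂(cond (μ : Measure X) U))) := by
  classical
  have hlim := ProbabilityMeasure.tendsto_measure_of_null_frontier_of_tendsto' hμ hfr
  let ν : ProbabilityMeasure X := ⟨cond (μ : Measure X) U, cond_isProbabilityMeasure hpos⟩
  let νs : ι → ProbabilityMeasure X := fun i ↦
    if h : (μs i : Measure X) U ≠ 0 then
      ⟨cond (μs i : Measure X) U, cond_isProbabilityMeasure h⟩
    else ν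
  have hνs : ∀ᶠ i in L, (νs i : Measure X) = cond (μs i : Measure X) U := by
    filter_upwards [hlim.eventually_ne hpos] with i hi
    simp [νs, hi]
  have hν : Tendsto νs L (𝓝 ν) := by
    refine tendsto_of_forall_isOpen_le_liminf' fun G hG ↦ ?_
    rw [liminf_congr (hνs.mono fun i hi ↦ congrArg (fun m : Measure X ↦ m G) hi)]
    rcases L.eq_or_neBot with rfl | hL
    · simp
    simp only [ν, ProbabilityMeasure.coe_mk, cond_apply hU.measurableSet]
    calc ((μ : Measure X) U)⁻¹ * (μ : Measure X) (U ∩ G)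
        ≤ liminf (fun i ↦ ((μs i : Measure X) U)⁻¹) L
          * liminf (fun i ↦ (μs i : Measure X) (U ∩ G)) L := by
          gcongr
          · exact (tendsto_inv_iff.2 hlim).liminf_eq.ge
          · exact ProbabilityMeasure.le_liminf_measure_open_of_tendsto hμ (hU.inter hG)
      _ ≤ _ := ENNReal.le_liminf_mul
  refine (ProbabilityMeasure.tendsto_iff_forall_integral_tendsto.1 hν g).congr' ?_
  filter_upwards [hνs] with i hi
  rw [hi]

/-- Between any two values there is a level that a measurable function attains only on a null
set. -/
theorem exists_null_level_between {X : Type*} [MeasurableSpace X] (μ : Measure X) [SFinite μ]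
    {f : X → ℝ} (hf : Measurable f) {a b : ℝ} (hab : a < b) :
    ∃ r, a < r ∧ r < b ∧ μ {x | f x = r} = 0 := by
  obtain ⟨r, hr, har, hrb⟩ :=
    ((Measure.countable_meas_level_set_pos (μ := μ) hf).dense_compl ℝ).exists_between hab
  exact ⟨r, har, hrb, by simpa using hr⟩

/-- Let `π_j → π` weakly (Borel probability measures on a metric space),
`f` continuous with `π {f > 0} = 1`, and `Ω_R := {f > 1/R}`.  Then there is a sequence
`R_k → ∞` such that: the sets `Ω_{R_k}` are eventually of positive `π`-measure,
`π_j (Ω_{R_k}) → π (Ω_{R_k})` for every `k`, and for all large `k` the measures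
`π_j (Ω_{R_k})⁻¹ • π_j|_{Ω_{R_k}}` are eventually well-defined probability measures and
converge weakly to `π (Ω_{R_k})⁻¹ • π|_{Ω_{R_k}}`. -/
theorem stmt_5 {X : Type*} [MetricSpace X] [MeasurableSpace X] [BorelSpace X]
    (π : ℕ → Measure X) (πl : Measure X)
    [∀ j, IsProbabilityMeasure (π j)] [IsProbabilityMeasure πl]
    (hweak : ∀ g : X → ℝ, Continuous g → (∃ C, ∀ z, |g z| ≤ C) →
      Tendsto (fun j => ∫ z, g z ∂(π j)) atTop (𝓝 (∫ z, g z ∂πl)))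
    (f : X → ℝ) (hf : Continuous f) (hpos : πl {x | 0 < f x} = 1) :
    ∃ R : ℕ → ℝ, (∀ k, 0 < R k) ∧ Tendsto R atTop atTop ∧
      (∀ k, Tendsto (fun j => π j {x | 1 / R k < f x}) atTop
        (𝓝 (πl {x | 1 / R k < f x}))) ∧
      ∃ k₀ : ℕ, ∀ k, k₀ ≤ k →
        0 < πl {x | 1 / R k < f x} ∧
        (∀ᶠ j in atTop, 0 < π j {x | 1 / R k < f x}) ∧
        ∀ g : X → ℝ, Continuous g → (∃ C, ∀ z, |g z| ≤ C) →
          Tendsto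
            (fun j => ∫ z, g z
              ∂((π j {x | 1 / R k < f x})⁻¹ • (π j).restrict {x | 1 / R k < f x}))
            atTop
            (𝓝 (∫ z, g z
              ∂((πl {x | 1 / R k < f x})⁻¹ • πl.restrict {x | 1 / R k < f x}))) := by
  let P : ProbabilityMeasure X := ⟨πl, inferInstance⟩
  let Ps : ℕ → ProbabilityMeasure X := fun j ↦ ⟨π j, inferInstance⟩
  have hP : Tendsto Ps atTop (𝓝 P) :=
    ProbabilityMeasure.tendsto_iff_forall_integral_tendsto.2 fun g ↦
      hweak g g.continuous ⟨‖g‖, g.norm_coe_le_norm⟩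
  choose r hr0 hr hnull using fun k : ℕ ↦
    exists_null_level_between πl hf.measurable (Nat.one_div_pos_of_nat (α := ℝ) (n := k))
  have hopen (k : ℕ) : IsOpen {x | r k < f x} := isOpen_lt continuous_const hf
  have hfr (k : ℕ) : πl (frontier {x | r k < f x}) = 0 :=
    measure_mono_null (frontier_lt_subset_eq continuous_const hf)
      (by simpa only [eq_comm] using hnull k)
  have hlim (k : ℕ) : Tendsto (fun j ↦ π j {x | r k < f x}) atTop (𝓝 (πl {x | r k < f x})) :=
    ProbabilityMeasure.tendsto_measure_of_null_frontier_of_tendsto' hP (hfr k)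
  obtain ⟨k₀, hk₀⟩ : ∃ n : ℕ, 0 < πl {x | 1 / ((n : ℝ) + 1) < f x} := by
    refine exists_measure_pos_of_not_measure_iUnion_null fun h ↦ ?_
    have : πl {x | 0 < f x} = 0 := by
      refine measure_mono_null (fun x (hx : 0 < f x) ↦ ?_) h
      exact Set.mem_iUnion.2 (exists_nat_one_div_lt hx)
    simp [this] at hpos
  refine ⟨fun k ↦ 1 / r k, fun k ↦ one_div_pos.2 (hr0 k), ?_, ?_⟩
  · refine tendsto_atTop_mono (fun k ↦ ?_) tendsto_natCast_atTop_atTop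
    have := (lt_one_div (hr0 k) (by positivity)).1 (hr k)
    linarith
  simp only [one_div_one_div]
  refine ⟨hlim, k₀, fun k hk ↦ ?_⟩
  have hposk : 0 < πl {x | r k < f x} := by
    refine hk₀.trans_le (measure_mono fun x hx ↦ ?_)
    exact ((hr k).trans_le (Nat.one_div_le_one_div hk)).trans hx
  refine ⟨hposk, (hlim k).eventually_const_lt hposk, fun g hg ⟨C, hC⟩ ↦ ?_⟩
  exact tendsto_integral_cond_of_null_frontier hP (hopen k) (hfr k) hposk.ne'
    (BoundedContinuousFunction.ofNormedAddCommGroup g hg C hC)
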